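/- arXiv:2111.05747 — 2 statements merged into one kernel-verified Lean document; each statement's English description precedes it below -/
import Mathlib

section
/- Let n≥2, let v₁,…,v_n be the standard unit coordinate vectors of ℝⁿ, let v₀ = −(v₁+…+v_n) = (−1,…,−1), and let ℓ₀,ℓ₁,…,ℓ_n > 0. For i=0,1,…,n let g_i:[0,ℓ_i]→ℝ be infinitely differentiable functions (with one-sided derivatives of all orders at the endpoints), and suppose that g₀(0)=g₁(0)=…=g_n(0) and that Σ_{i=0}^{n} g_i'(0) = 0. Then there exists an infinitely differentiable function F:ℝⁿ→ℝ such that F(t·v_i) = g_i(t) for all t∈[0,ℓ_i] and all i=0,1,…,n. -/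
noncomputable section

/-- The directions of the star in `ℝⁿ`: `vdir n (some i) = vᵢ` is the `i`-th standard
unit coordinate vector, and `vdir n none = v₀ = -(v₁ + ⋯ + v_n) = (-1, …, -1)`. -/
def vdir (n : ℕ) : Option (Fin n) → (Fin n → ℝ) :=
  fun o => o.elim (fun _ => (-1 : ℝ)) (fun i => Pi.single i 1)

open Set Filter Topology

theorem star_chain (D : ℕ → ℝ → ℝ) (h : ∀ k x, HasDerivAt (D k) (D (k+1) x) x) :
    ContDiff ℝ (⊤ : ℕ∞) (D 0) := by
  have e : ∀ k, iteratedDeriv k (D 0) = D k := by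
    intro k
    induction k with
    | zero => simp
    | succ k ih =>
      rw [iteratedDeriv_succ, ih]
      ext x
      exact (h k x).deriv
  apply contDiff_of_differentiable_iteratedDeriv
  intro m _
  rw [e]
  exact fun x => (h m x).differentiableAt

theorem star_hadamard (h : ℝ → ℝ) (hh : ContDiff ℝ (⊤ : ℕ∞) h) (h0 : h 0 = 0) :
    ∃ k : ℝ → ℝ, ContDiff ℝ (⊤ : ℕ∞) k ∧ ∀ t, h t = t * k t := by
  have hc : ∀ m, Continuous (iteratedDeriv m h) := fun m =>
    hh.continuous_iteratedDeriv m (by exact_mod_cast le_top)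
  have hd : ∀ m x, HasDerivAt (iteratedDeriv m h) (iteratedDeriv (m+1) h x) x := by
    intro m x
    rw [iteratedDeriv_succ]
    exact (hh.differentiable_iteratedDeriv m
      (by exact_mod_cast WithTop.coe_lt_top _) x).hasDerivAt
  refine ⟨fun t => ∫ s in (0:ℝ)..1, s ^ 0 * iteratedDeriv 1 h (t * s), ?_, ?_⟩
  · refine star_chain (fun m t => ∫ s in (0:ℝ)..1, s ^ m * iteratedDeriv (m+1) h (t * s)) ?_
    intro m x
    have hc2 : Continuous (fun p : ℝ × ℝ => p.2 ^ (m+1) * iteratedDeriv (m+1+1) h (p.1 * p.2)) := by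
      have := hc (m+1+1)
      fun_prop
    obtain ⟨C, hC⟩ := (((isCompact_Icc (a := x - 1) (b := x + 1)).prod
      (isCompact_Icc (a := (0:ℝ)) (b := 1))).exists_bound_of_continuousOn hc2.continuousOn)
    refine (intervalIntegral.hasDerivAt_integral_of_dominated_loc_of_deriv_le
      (F' := fun t s => s ^ (m+1) * iteratedDeriv (m+1+1) h (t * s)) (bound := fun _ => C)
      (Icc_mem_nhds (a := x-1) (b := x+1) (by linarith) (by linarith)) ?_ ?_ ?_ ?_ ?_ ?_).2
    · refine Eventually.of_forall fun t => Continuous.aestronglyMeasurable ?_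
      have := hc (m+1)
      fun_prop
    · apply Continuous.intervalIntegrable
      have := hc (m+1)
      fun_prop
    · refine Continuous.aestronglyMeasurable ?_
      have := hc (m+1+1)
      fun_prop
    · refine Eventually.of_forall fun s hs t ht => ?_
      rw [uIoc_of_le zero_le_one] at hs
      exact hC (t, s) ⟨ht, hs.1.le, hs.2⟩
    · simp
    · refine Eventually.of_forall fun s hs t ht => ?_
      have h1 : HasDerivAt (fun t : ℝ => t * s) s t := by
        simpa using (hasDerivAt_id t).mul_const s
      have := ((hd (m+1) (t*s)).comp t h1).const_mul (s^m)
      exact this.congr_deriv (by ring)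
  · intro t
    have : ∫ s in (0:ℝ)..1, t * iteratedDeriv 1 h (t * s) = h (t*1) - h (t*0) := by
      refine intervalIntegral.integral_eq_sub_of_hasDerivAt (f := fun s => h (t*s)) ?_ ?_
      · intro s _
        have h1 : HasDerivAt (fun s : ℝ => t * s) t s := by
          simpa using (hasDerivAt_id s).const_mul t
        have h2 := hd 0 (t*s)
        rw [iteratedDeriv_zero] at h2
        have := h2.comp s h1
        exact this.congr_deriv (by ring)
      · apply Continuous.intervalIntegrable
        have := hc 1
        fun_prop
    simp only [pow_zero, one_mul, mul_one, mul_zero, h0, sub_zero,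
      intervalIntegral.integral_const_mul] at this ⊢
    exact this.symm

theorem star_flat (f : ℝ → ℝ) (a b : ℝ) (hab : a < b) (hf : ContDiffOn ℝ (⊤ : ℕ∞) f (Icc a b))
    (ha : ∀ k, iteratedDerivWithin k f (Icc a b) a = 0)
    (hb : ∀ k, iteratedDerivWithin k f (Icc a b) b = 0) :
    ContDiff ℝ (⊤ : ℕ∞) ((Icc a b).indicator f) := by
  have hu : UniqueDiffOn ℝ (Icc a b) := uniqueDiffOn_Icc hab
  have key := star_chain (fun k => (Icc a b).indicator (iteratedDerivWithin k f (Icc a b))) ?_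
  · simpa using key
  intro k x
  by_cases hx : x ∈ Icc a b
  · have hd : HasDerivWithinAt ((Icc a b).indicator (iteratedDerivWithin k f (Icc a b)))
        (iteratedDerivWithin (k+1) f (Icc a b) x) (Icc a b) x := by
      rw [iteratedDerivWithin_succ]
      refine (hf.differentiableOn_iteratedDerivWithin (m := k)
        (by exact_mod_cast WithTop.coe_lt_top _) hu x hx).hasDerivWithinAt.congr ?_ ?_
      · intro y hy; simp [indicator_of_mem hy]
      · simp [indicator_of_mem hx]
    simp only [indicator_of_mem hx]
    by_cases hi : x ∈ Ioo a b
    · exact hd.hasDerivAt (Icc_mem_nhds hi.1 hi.2)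
    · have hz : ∀ k, iteratedDerivWithin k f (Icc a b) x = 0 := by
        have : x = a ∨ x = b := by
          by_contra! hne
          exact hi ⟨lt_of_le_of_ne hx.1 hne.1.symm, lt_of_le_of_ne hx.2 hne.2⟩
        rcases this with rfl | rfl
        · exact ha
        · exact hb
      rw [hz] at hd ⊢
      have h2 : HasDerivWithinAt ((Icc a b).indicator (iteratedDerivWithin k f (Icc a b)))
          0 (Icc a b)ᶜ x := by
        refine (hasDerivWithinAt_const x _ (0:ℝ)).congr ?_ ?_
        · intro y hy; simp [indicator_of_notMem hy]
        · simp [indicator_of_mem hx, hz]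
      have := hd.union h2
      rwa [union_compl_self, hasDerivWithinAt_univ] at this
  · simp only [indicator_of_notMem hx]
    refine (hasDerivAt_const x (0:ℝ)).congr_of_eventuallyEq ?_
    filter_upwards [isClosed_Icc.isOpen_compl.mem_nhds hx] with y hy
    simp [indicator_of_notMem hy]

theorem star_borel (a : ℕ → ℝ) : ∃ B : ℝ → ℝ, ContDiff ℝ (⊤ : ℕ∞) B ∧
    ∀ k, iteratedDeriv k B 0 = a k := by
  let χ : ContDiffBump (0:ℝ) := default
  let ψ : ℕ → ℝ → ℝ := fun n y => y ^ n * χ y / (n.factorial : ℝ)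
  have hχ : ContDiff ℝ (⊤ : ℕ∞) χ := χ.contDiff
  have hψ : ∀ n, ContDiff ℝ (⊤ : ℕ∞) (ψ n) := fun n => by
    simp only [ψ]; fun_prop
  have hψc : ∀ n, HasCompactSupport (ψ n) := fun n => by
    have : HasCompactSupport (fun y => y ^ n * χ y) := χ.hasCompactSupport.mul_left
    refine this.mono ?_
    intro y hy
    simp only [ψ, Function.mem_support] at hy ⊢
    intro h
    exact hy (by rw [h]; simp)
  have hM : ∀ n k, ∃ C, 0 ≤ C ∧ ∀ x, |iteratedDeriv k (ψ n) x| ≤ C := by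
    intro n k
    obtain ⟨C, hC⟩ := ((hψc n).iteratedFDeriv (𝕜 := ℝ) k).exists_bound_of_continuous
      ((hψ n).continuous_iteratedFDeriv (by exact_mod_cast le_top))
    refine ⟨C, (norm_nonneg _).trans (hC 0), fun x => ?_⟩
    have := hC x
    rwa [norm_iteratedFDeriv_eq_norm_iteratedDeriv] at this
  choose M hM0 hM using hM
  let q : ℕ → ℝ := fun n => 2 ^ n * (|a n| + 1) * (1 + ∑ k ∈ Finset.range n, M n k)
  have hS : ∀ n, 0 ≤ ∑ k ∈ Finset.range n, M n k := fun n =>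
    Finset.sum_nonneg fun k _ => hM0 n k
  have hq1 : ∀ n, 1 ≤ q n := fun n =>
    one_le_mul_of_one_le_of_one_le (one_le_mul_of_one_le_of_one_le
      (one_le_pow₀ (by norm_num)) (by linarith [abs_nonneg (a n)])) (by linarith [hS n])
  have hq0 : ∀ n, 0 < q n := fun n => lt_of_lt_of_le one_pos (hq1 n)
  let u : ℕ → ℝ → ℝ := fun n x => (a n * (q n)⁻¹ ^ n) * ψ n (q n * x)
  have hu : ∀ n, ContDiff ℝ (⊤ : ℕ∞) (u n) := fun n => by
    have := hψ n
    simp only [u]; fun_prop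
  have hder : ∀ n k x, iteratedDeriv k (u n) x =
      (a n * (q n)⁻¹ ^ n) * (q n ^ k * iteratedDeriv k (ψ n) (q n * x)) := by
    intro n k x
    have h1 : ContDiff ℝ k (ψ n) := (hψ n).of_le (by exact_mod_cast le_top)
    simp only [u]
    rw [iteratedDeriv_const_mul_field, iteratedDeriv_comp_const_mul h1]
  let v : ℕ → ℕ → ℝ := fun k n => if k < n then (1/2) ^ n else
    |a n * (q n)⁻¹ ^ n| * (q n ^ k * M n k)
  have hv : ∀ k, Summable (v k) := by
    intro k
    refine (summable_geometric_of_lt_one (r := (1/2 : ℝ)) (by norm_num)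
      (by norm_num)).congr_cofinite ?_
    rw [Nat.cofinite_eq_atTop]
    filter_upwards [eventually_gt_atTop k] with n hn
    simp [v, hn]
  have hb : ∀ k n x, ‖iteratedFDeriv ℝ k (u n) x‖ ≤ v k n := by
    intro k n x
    rw [norm_iteratedFDeriv_eq_norm_iteratedDeriv, hder, Real.norm_eq_abs, abs_mul,
      abs_mul (q n ^ k), abs_of_pos (pow_pos (hq0 n) k)]
    have h1 : |a n * (q n)⁻¹ ^ n| * (q n ^ k * |iteratedDeriv k (ψ n) (q n * x)|) ≤
        |a n * (q n)⁻¹ ^ n| * (q n ^ k * M n k) := by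
      have := hM n k (q n * x)
      have := (hq0 n).le
      gcongr
    refine h1.trans ?_
    simp only [v]
    split_ifs with hkn
    · have h2 : (q n)⁻¹ ^ n * q n ^ k ≤ (q n)⁻¹ := by
        obtain ⟨d, rfl⟩ : ∃ d, n = k + (d + 1) := ⟨n - k - 1, by omega⟩
        have : (q (k + (d + 1)))⁻¹ ^ (k + (d + 1)) * q (k + (d + 1)) ^ k
          = (q (k + (d + 1)))⁻¹ ^ (d + 1) := by
          rw [pow_add, mul_right_comm, ← mul_pow, inv_mul_cancel₀ (hq0 _).ne', one_pow, one_mul]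
        rw [this]
        exact pow_le_of_le_one (inv_nonneg.2 (hq0 _).le) (inv_le_one_of_one_le₀ (hq1 _))
          (by omega)
      have h3 : M n k ≤ 1 + ∑ k ∈ Finset.range n, M n k := by
        have := Finset.single_le_sum (f := fun k => M n k) (fun i _ => hM0 n i)
          (Finset.mem_range.2 hkn)
        linarith
      rw [abs_mul, abs_of_nonneg (pow_nonneg (inv_nonneg.2 (hq0 n).le) n)]
      calc |a n| * (q n)⁻¹ ^ n * (q n ^ k * M n k)
          = |a n| * ((q n)⁻¹ ^ n * q n ^ k) * M n k := by ring
        _ ≤ (|a n| + 1) * (q n)⁻¹ * (1 + ∑ k ∈ Finset.range n, M n k) := by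
          have := (hq0 n).le
          have := hM0 n k
          gcongr
          linarith
        _ = (1/2)^n := by
          have e1 : |a n| + 1 ≠ 0 := by positivity
          have e2 : 1 + ∑ k ∈ Finset.range n, M n k ≠ 0 := by linarith [hS n]
          simp only [q, one_div, inv_pow]
          field_simp
    · exact le_rfl
  have hat : ∀ k n, iteratedDeriv k (u n) 0 = if k = n then a n else 0 := by
    intro k n
    have he : u n =ᶠ[𝓝 0] fun x => (a n / n.factorial) * x ^ n := by
      have ht : Tendsto (fun x => q n * x) (𝓝 0) (𝓝 0) := by
        have : Continuous (fun x => q n * x) := by fun_prop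
        simpa using this.tendsto 0
      filter_upwards [ht.eventually χ.eventuallyEq_one] with x hx
      simp only [u, ψ, hx, Pi.one_apply, mul_pow, inv_pow]
      have := (pow_pos (hq0 n) n).ne'
      field_simp
    rw [he.iteratedDeriv_eq, iteratedDeriv_const_mul_field, iteratedDeriv_fun_pow_zero]
    have := n.factorial_ne_zero
    split_ifs
    · field_simp
    · simp
  refine ⟨fun x => ∑' n, u n x, contDiff_tsum (v := v) hu (fun k _ => hv k)
    (fun k n x _ => hb k n x), ?_⟩
  intro k
  rw [iteratedDeriv_eq_iteratedFDeriv, iteratedFDeriv_tsum_apply (v := v) (N := ⊤) hu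
    (fun k _ => hv k) (fun k n x _ => hb k n x) le_top, tsum_eq_single k,
    ← iteratedDeriv_eq_iteratedFDeriv, hat, if_pos rfl]
  intro n hn
  rw [← norm_eq_zero, norm_iteratedFDeriv_eq_norm_iteratedDeriv, hat, if_neg hn.symm, norm_zero]

theorem star_ext (f : ℝ → ℝ) (l : ℝ) (hl : 0 < l) (hf : ContDiffOn ℝ (⊤ : ℕ∞) f (Icc 0 l)) :
    ∃ G : ℝ → ℝ, ContDiff ℝ (⊤ : ℕ∞) G ∧ EqOn G f (Icc 0 l) := by
  obtain ⟨B0, hB0, hd0⟩ := star_borel (fun k => iteratedDerivWithin k f (Icc 0 l) 0)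
  obtain ⟨B1, hB1, hd1⟩ := star_borel (fun k => iteratedDerivWithin k f (Icc 0 l) l)
  let φ : ℝ → ℝ := fun x => Real.smoothTransition (3 * x / l - 1)
  have hφ : ContDiff ℝ (⊤ : ℕ∞) φ := Real.smoothTransition.contDiff.comp (by fun_prop)
  let b : ℝ → ℝ := fun x => (1 - φ x) * B0 x + φ x * B1 (x - l)
  have hb : ContDiff ℝ (⊤ : ℕ∞) b := by
    simp only [b]; fun_prop
  have e0 : b =ᶠ[𝓝 0] B0 := by
    filter_upwards [Iio_mem_nhds (show 0 < l/3 by positivity)] with x hx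
    have : φ x = 0 := Real.smoothTransition.zero_of_nonpos (by
      rw [sub_nonpos, div_le_one hl]; linarith [mem_Iio.1 hx])
    simp [b, this]
  have e1 : b =ᶠ[𝓝 l] fun x => B1 (x - l) := by
    filter_upwards [Ioi_mem_nhds (show 2*l/3 < l by linarith)] with x hx
    have : φ x = 1 := Real.smoothTransition.one_of_one_le (by
      rw [le_sub_iff_add_le, le_div_iff₀ hl]; linarith [mem_Ioi.1 hx])
    simp [b, this]
  have hu : UniqueDiffOn ℝ (Icc 0 l) := uniqueDiffOn_Icc hl
  have hsub : ∀ k, ∀ x ∈ Icc 0 l, iteratedDerivWithin k (f - b) (Icc 0 l) x =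
      iteratedDerivWithin k f (Icc 0 l) x - iteratedDeriv k b x := by
    intro k x hx
    have hbk : ContDiff ℝ k b := hb.of_le (by exact_mod_cast le_top)
    rw [iteratedDerivWithin_sub hx hu ((hf x hx).of_le (by exact_mod_cast le_top))
      hbk.contDiffWithinAt, iteratedDerivWithin_eq_iteratedDeriv hu hbk.contDiffAt hx]
  have h := star_flat (f - b) 0 l hl (hf.sub hb.contDiffOn)
    (fun k => by rw [hsub k 0 ⟨le_rfl, hl.le⟩, e0.iteratedDeriv_eq, hd0, sub_self])
    (fun k => by
      rw [hsub k l ⟨hl.le, le_rfl⟩, e1.iteratedDeriv_eq, iteratedDeriv_comp_sub_const]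
      beta_reduce
      rw [sub_self, hd1, sub_self])
  refine ⟨fun x => (Icc 0 l).indicator (f - b) x + b x, h.add hb, ?_⟩
  intro x hx
  simp [indicator_of_mem hx]

/-! **Statement 16.** (Bryant's extension lemma.)  Let `n ≥ 2`, let `v₁, …, v_n` be the
standard unit vectors of `ℝⁿ` and `v₀ = (-1, …, -1)`, and let `ℓᵢ > 0` for
`i = 0, 1, …, n` (indexed here by `Option (Fin n)`, with `none` playing the role of the
index `0`).  Given functions `gᵢ : [0, ℓᵢ] → ℝ`, infinitely differentiable in the
one-sided sense (`ContDiffOn` on the closed interval), with `g₀(0) = g₁(0) = ⋯ = g_n(0)`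
and `∑_{i=0}^n gᵢ'(0) = 0` (right-hand derivatives at `0`), there is a `C^∞` function
`F : ℝⁿ → ℝ` with `F(t·vᵢ) = gᵢ(t)` for all `t ∈ [0, ℓᵢ]` and all `i`. -/
theorem smooth_extension_star (n : ℕ) (hn : 2 ≤ n)
    (ℓ : Option (Fin n) → ℝ) (hℓ : ∀ i, 0 < ℓ i)
    (g : Option (Fin n) → ℝ → ℝ)
    (hg : ∀ i, ContDiffOn ℝ (⊤ : ℕ∞) (g i) (Set.Icc 0 (ℓ i)))
    (hval : ∀ i j, g i 0 = g j 0)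
    (hbal : ∑ i : Option (Fin n), derivWithin (g i) (Set.Icc 0 (ℓ i)) 0 = 0) :
    ∃ F : (Fin n → ℝ) → ℝ, ContDiff ℝ (⊤ : ℕ∞) F ∧
      ∀ i : Option (Fin n), ∀ t ∈ Set.Icc 0 (ℓ i), F (t • vdir n i) = g i t := by
  choose G hG hGg using fun i => star_ext (g i) (ℓ i) (hℓ i) (hg i)
  have hz : ∀ i, (0:ℝ) ∈ Icc 0 (ℓ i) := fun i => ⟨le_rfl, (hℓ i).le⟩
  have hGd : ∀ i x, HasDerivAt (G i) (deriv (G i) x) x := fun i x =>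
    ((hG i).differentiable (by simp) x).hasDerivAt
  have hder : ∀ i, deriv (G i) 0 = derivWithin (g i) (Icc 0 (ℓ i)) 0 := by
    intro i
    rw [← derivWithin_congr (hGg i) (hGg i (hz i))]
    exact ((hGd i 0).hasDerivWithinAt.derivWithin
      (uniqueDiffOn_Icc (hℓ i) 0 (hz i))).symm
  let c := g none 0
  have hG0 : ∀ i, G i 0 = c := fun i => (hGg i (hz i)).trans (hval i none)
  let h : ℝ → ℝ := fun t => G none t - c - ∑ i : Fin n, (G (some i) (-t) - c)
  have hh : ContDiff ℝ (⊤ : ℕ∞) h := by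
    refine ((hG none).sub contDiff_const).sub (ContDiff.sum fun i _ => ?_)
    exact ((hG (some i)).comp contDiff_neg).sub contDiff_const
  have hh0 : h 0 = 0 := by simp [h, hG0]
  have hh1 : HasDerivAt h 0 0 := by
    have h1 : ∀ i : Fin n, HasDerivAt (fun t => G (some i) (-t) - c)
        (-deriv (G (some i)) 0) 0 := by
      intro i
      have h2 := hGd (some i) (-0)
      have := (h2.comp (0:ℝ) (hasDerivAt_neg (0:ℝ))).sub_const c
      simpa using this
    have h3 := ((hGd none 0).sub_const c).sub (HasDerivAt.fun_sum (u := Finset.univ)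
      fun i _ => h1 i)
    have h4 : deriv (G none) 0 - ∑ i : Fin n, -deriv (G (some i)) 0 = 0 := by
      rw [Fintype.sum_option] at hbal
      simpa [hder] using hbal
    rw [h4] at h3
    exact h3
  obtain ⟨k1, hk1, hhk1⟩ := star_hadamard h hh hh0
  have hk10 : k1 0 = 0 := by
    have h1 : HasDerivAt (fun t => t * k1 t) (1 * k1 0 + 0 * deriv k1 0) 0 :=
      (hasDerivAt_id (0:ℝ)).mul ((hk1.differentiable (by simp) 0).hasDerivAt)
    have h2 : h = fun t => t * k1 t := funext hhk1
    rw [h2] at hh1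
    simpa using h1.unique hh1
  obtain ⟨k, hk, hk1k⟩ := star_hadamard k1 hk1 hk10
  let p : Fin n := ⟨0, by omega⟩
  let r : Fin n := ⟨1, by omega⟩
  refine ⟨fun x => c + ∑ i : Fin n, (G (some i) (x i) - c) + x p * x r * k (-x p), ?_, ?_⟩
  · refine (contDiff_const.add (ContDiff.sum fun i _ => ?_)).add ?_
    · exact ((hG (some i)).comp (contDiff_apply ℝ ℝ i)).sub contDiff_const
    · exact ((contDiff_apply ℝ ℝ p).mul (contDiff_apply ℝ ℝ r)).mul
        (hk.comp (contDiff_apply ℝ ℝ p).neg)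
  · intro i t ht
    rw [← hGg i ht]
    cases i with
    | none =>
      have e1 := hhk1 t
      rw [hk1k t] at e1
      simp only [h] at e1
      simp only [vdir, Option.elim, Pi.smul_apply, smul_eq_mul, mul_neg, mul_one, neg_neg]
      linarith
    | some j =>
      have e1 : ∑ i : Fin n, (G (some i) ((t • vdir n (some j)) i) - c) = G (some j) t - c := by
        rw [Finset.sum_eq_single j]
        · simp [vdir]
        · intro i _ hij
          simp [vdir, Pi.single_eq_of_ne hij, hG0]
        · simp
      have e2 : (t • vdir n (some j)) p * (t • vdir n (some j)) r = 0 := by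
        by_cases hj : p = j
        · have : r ≠ j := by
            rw [← hj]; simp [p, r]
          simp [vdir, Pi.single_eq_of_ne this]
        · simp [vdir, Pi.single_eq_of_ne hj]
      simp only [e1, e2]
      ring
end
end

section
/- Every infinitely differentiable function f:[0,1]→ℝ (all derivatives existing on (0,1), with one-sided derivatives of all orders at the endpoints 0 and 1) is the restriction to [0,1] of an infinitely differentiable function on ℝ. -/
open Set Filter Topology

lemma bounded_iterated (h : ℝ → ℝ) (hh : ContDiff ℝ (⊤ : ℕ∞) h) (hc : HasCompactSupport h) (k : ℕ) :
    ∃ C, ∀ x, |iteratedDeriv k h x| ≤ C := by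
  obtain ⟨C, hC⟩ := (hc.iteratedFDeriv (𝕜 := ℝ) k).exists_bound_of_continuous
    (hh.continuous_iteratedFDeriv (m := k) (mod_cast le_top))
  refine ⟨C, fun x => ?_⟩
  rw [← Real.norm_eq_abs, ← norm_iteratedFDeriv_eq_norm_iteratedDeriv]
  exact hC x

lemma iterated_scaled (h : ℝ → ℝ) (hh : ContDiff ℝ (⊤ : ℕ∞) h) (k : ℕ) (b l x : ℝ) :
    iteratedDeriv k (fun x => b * h (l * x)) x = b * (l ^ k * iteratedDeriv k h (l * x)) := by
  rw [iteratedDeriv_const_mul_field b (fun x => h (l * x)),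
    iteratedDeriv_comp_const_smul (hh.of_le (mod_cast le_top)) l]
  simp

lemma exists_scale (h : ℝ → ℝ) (hh : ContDiff ℝ (⊤ : ℕ∞) h) (hc : HasCompactSupport h)
    (n : ℕ) (a : ℝ) : ∃ l : ℝ, 1 ≤ l ∧ ∀ k < n, ∀ x,
      |iteratedDeriv k (fun x => (a * (l ^ n)⁻¹) * h (l * x)) x| ≤ (1 / 2) ^ n := by
  choose C hC using bounded_iterated h hh hc
  have hC0 : ∀ k, 0 ≤ C k := fun k => (abs_nonneg _).trans (hC k 0)
  set M := ∑ k ∈ Finset.range n, C k with hM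
  have hM0 : 0 ≤ M := Finset.sum_nonneg fun k _ => hC0 k
  have h2 : (0 : ℝ) ≤ |a| * M * 2 ^ n := by positivity
  refine ⟨1 + |a| * M * 2 ^ n, by linarith, fun k hk x => ?_⟩
  set l := 1 + |a| * M * 2 ^ n with hl
  have hl1 : 1 ≤ l := by linarith
  have hl0 : 0 < l := by linarith
  have hCM : C k ≤ M := Finset.single_le_sum (fun k _ => hC0 k) (Finset.mem_range.2 hk)
  rw [iterated_scaled h hh]
  have hb := (hC k (l * x)).trans hCM
  have hp : l ^ (k + 1) ≤ l ^ n := pow_le_pow_right₀ hl1 hk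
  rw [abs_mul, abs_mul, abs_mul, abs_inv, abs_of_pos (pow_pos hl0 n), abs_of_pos (pow_pos hl0 k)]
  have h3 : (l ^ n)⁻¹ * l ^ k ≤ l⁻¹ := by
    rw [inv_mul_le_iff₀ (pow_pos hl0 n), ← div_eq_mul_inv, le_div_iff₀ hl0, ← pow_succ]
    exact hp
  calc |a| * (l ^ n)⁻¹ * (l ^ k * |iteratedDeriv k h (l * x)|)
      = |a| * (((l ^ n)⁻¹ * l ^ k) * |iteratedDeriv k h (l * x)|) := by ring
    _ ≤ |a| * (l⁻¹ * M) := by gcongr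
    _ ≤ (1 / 2) ^ n := by
      rw [one_div, inv_pow, show |a| * (l⁻¹ * M) = (|a| * M) / l by ring, div_le_iff₀ hl0,
        le_inv_mul_iff₀ (by positivity)]
      linarith

lemma iterated_monomial (a : ℝ) (n k : ℕ) :
    iteratedDeriv k (fun x : ℝ => (a / n.factorial) * x ^ n) 0 = if n = k then a else 0 := by
  rw [iteratedDeriv_const_mul_field (a / n.factorial) (fun x : ℝ => x ^ n),
    iteratedDeriv_eq_iterate, iter_deriv_pow]
  have hn : (n.factorial : ℝ) ≠ 0 := by positivity
  rcases lt_trichotomy n k with h | h | h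
  · rw [Finset.prod_eq_zero (Finset.mem_range.2 h) (sub_self _)]
    simp [h.ne]
  · subst h
    have : (∏ i ∈ Finset.range n, ((n : ℝ) - i)) = n.factorial := by
      rw [← Nat.descFactorial_self, Nat.descFactorial_eq_prod_range, Nat.cast_prod]
      refine Finset.prod_congr rfl fun i hi => ?_
      rw [Nat.cast_sub (Finset.mem_range.1 hi).le]
    rw [this]
    simp [hn]
  · simp [h.ne', Nat.sub_ne_zero_of_lt h]

lemma borel_zero (a : ℕ → ℝ) :
    ∃ g : ℝ → ℝ, ContDiff ℝ (⊤ : ℕ∞) g ∧ ∀ n, iteratedDeriv n g 0 = a n := by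
  let χ : ContDiffBump (0 : ℝ) := ⟨1, 2, by norm_num, by norm_num⟩
  let h : ℕ → ℝ → ℝ := fun n x => χ x * (x ^ n / n.factorial)
  have hh : ∀ n, ContDiff ℝ (⊤ : ℕ∞) (h n) := fun n =>
    χ.contDiff.mul ((contDiff_id.pow n).div_const _)
  have hc : ∀ n, HasCompactSupport (h n) := fun n => χ.hasCompactSupport.mul_right
  choose l hl1 hl using fun n => exists_scale (h n) (hh n) (hc n) n (a n)
  let g : ℕ → ℝ → ℝ := fun n x => (a n * (l n ^ n)⁻¹) * h n (l n * x)
  have hg : ∀ n, ContDiff ℝ (⊤ : ℕ∞) (g n) := fun n =>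
    contDiff_const.mul ((hh n).comp (contDiff_const.mul contDiff_id))
  have hB : ∀ n k, ∃ C, ∀ x, |iteratedDeriv k (g n) x| ≤ C := by
    intro n k
    obtain ⟨C, hC⟩ := bounded_iterated (h n) (hh n) (hc n) k
    refine ⟨|a n * (l n ^ n)⁻¹| * (|l n ^ k| * C), fun x => ?_⟩
    rw [iterated_scaled (h n) (hh n), abs_mul, abs_mul (l n ^ k)]
    gcongr
    exact hC _
  choose C hC using hB
  let v : ℕ → ℕ → ℝ := fun k n => if k < n then (1 / 2) ^ n else C n k
  have hv : ∀ k : ℕ, (k : ℕ∞) ≤ ⊤ → Summable (v k) := by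
    intro k _
    refine summable_geometric_two.congr_atTop ?_
    filter_upwards [eventually_gt_atTop k] with n hn
    simp [v, hn]
  have hgv : ∀ (k n : ℕ) (x : ℝ), (k : ℕ∞) ≤ ⊤ → ‖iteratedFDeriv ℝ k (g n) x‖ ≤ v k n := by
    intro k n x _
    rw [norm_iteratedFDeriv_eq_norm_iteratedDeriv, Real.norm_eq_abs]
    by_cases hkn : k < n
    · simp only [v, if_pos hkn]
      exact hl n k hkn x
    · simp only [v, if_neg hkn]
      exact hC n k x
  refine ⟨fun x => ∑' n, g n x, contDiff_tsum hg hv hgv, fun k => ?_⟩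
  have hval : ∀ n, iteratedDeriv k (g n) 0 = if n = k then a n else 0 := by
    intro n
    rw [← iterated_monomial]
    apply Filter.EventuallyEq.iteratedDeriv_eq
    have hl0 : l n ≠ 0 := by linarith [hl1 n]
    have ht : Tendsto (fun x : ℝ => l n * x) (𝓝 0) (𝓝 0) := by
      have : Continuous (fun x : ℝ => l n * x) := by fun_prop
      simpa using this.tendsto 0
    filter_upwards [ht.eventually χ.eventuallyEq_one] with x hx
    simp only [g, h, hx, Pi.one_apply]
    rw [mul_pow]
    field_simp
  have hs : Summable fun n => iteratedFDeriv ℝ k (g n) 0 :=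
    .of_norm_bounded (hv k le_top) fun n => hgv k n 0 le_top
  rw [iteratedDeriv_eq_iteratedFDeriv, iteratedFDeriv_tsum_apply hg hv hgv le_top,
    ContinuousMultilinearMap.tsum_eval hs]
  simp_rw [← iteratedDeriv_eq_iteratedFDeriv, hval]
  exact tsum_ite_eq k a

lemma borel_at (c : ℝ) (a : ℕ → ℝ) :
    ∃ g : ℝ → ℝ, ContDiff ℝ (⊤ : ℕ∞) g ∧ ∀ n, iteratedDeriv n g c = a n := by
  obtain ⟨g, hg, hga⟩ := borel_zero a
  refine ⟨fun x => g (x - c), hg.comp (contDiff_id.sub contDiff_const), fun n => ?_⟩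
  rw [iteratedDeriv_comp_sub_const]
  simp [hga]

lemma contDiff_of_family (D : ℕ → ℝ → ℝ) (hD : ∀ n x, HasDerivAt (D n) (D (n + 1) x) x) :
    ContDiff ℝ (⊤ : ℕ∞) (D 0) := by
  have : ∀ n, iteratedDeriv n (D 0) = D n := by
    intro n
    induction n with
    | zero => simp
    | succ n ih => rw [iteratedDeriv_succ, ih]; exact funext fun x => (hD n x).deriv
  refine contDiff_of_differentiable_iteratedDeriv fun m _ => ?_
  rw [this]
  exact fun x => (hD m x).differentiableAt

lemma hasDerivWithinAt_piece (s : Set ℝ) (hs : IsClosed s) (u u' w w' : ℝ → ℝ)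
    (hu : ∀ x ∈ s, u x = w x) (hu' : ∀ x ∈ s, u' x = w' x)
    (hw : ∀ x ∈ s, HasDerivWithinAt w (w' x) s x) (x : ℝ) :
    HasDerivWithinAt u (u' x) s x := by
  by_cases hx : x ∈ s
  · rw [hu' x hx]
    exact (hw x hx).congr hu (hu x hx)
  · exact HasFDerivWithinAt.of_notMem_closure (by rwa [hs.closure_eq])

lemma hasDerivAt_iterated (g : ℝ → ℝ) (hg : ContDiff ℝ (⊤ : ℕ∞) g) (n : ℕ) (x : ℝ) :
    HasDerivAt (iteratedDeriv n g) (iteratedDeriv (n + 1) g x) x := by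
  rw [iteratedDeriv_succ]
  exact (hg.differentiable_iteratedDeriv n (mod_cast ENat.natCast_lt_top n) x).hasDerivAt

/-! **Statement 17.**  Every infinitely differentiable function `f : [0,1] → ℝ` (all
derivatives existing on `(0,1)`, with one-sided derivatives of all orders at the
endpoints `0` and `1` — i.e. `f` is `C^∞` on the closed interval `[0,1]` in the sense of
`ContDiffOn`) is the restriction to `[0,1]` of an infinitely differentiable function
on `ℝ`. -/
theorem smooth_extension_from_interval (f : ℝ → ℝ)
    (hf : ContDiffOn ℝ (⊤ : ℕ∞) f (Set.Icc (0 : ℝ) 1)) :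
    ∃ F : ℝ → ℝ, ContDiff ℝ (⊤ : ℕ∞) F ∧ ∀ x ∈ Set.Icc (0 : ℝ) 1, F x = f x := by
  set I := Icc (0 : ℝ) 1 with hI
  have hud : UniqueDiffOn ℝ I := uniqueDiffOn_Icc zero_lt_one
  obtain ⟨g, hg, hga⟩ := borel_at 0 (fun n => iteratedDerivWithin n f I 0)
  obtain ⟨k, hk, hka⟩ := borel_at 1 (fun n => iteratedDerivWithin n f I 1)
  let D : ℕ → ℝ → ℝ := fun n x => if x < 0 then iteratedDeriv n g x
    else if x ≤ 1 then iteratedDerivWithin n f I x else iteratedDeriv n k x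
  have h1 : ∀ n, ∀ x ∈ Iic (0 : ℝ), D n x = iteratedDeriv n g x := by
    intro n x hx
    rcases lt_or_eq_of_le (mem_Iic.1 hx) with h | h
    · simp [D, h]
    · subst h
      simp [D, hga]
  have h2 : ∀ n, ∀ x ∈ I, D n x = iteratedDerivWithin n f I x := by
    intro n x hx
    simp [D, not_lt.2 hx.1, hx.2]
  have h3 : ∀ n, ∀ x ∈ Ici (1 : ℝ), D n x = iteratedDeriv n k x := by
    intro n x hx
    have hx0 : ¬ x < 0 := by have := mem_Ici.1 hx; linarith
    rcases lt_or_eq_of_le (mem_Ici.1 hx) with h | h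
    · simp [D, hx0, not_le.2 h]
    · subst h
      simp [D, hka, hx0]
  refine ⟨D 0, contDiff_of_family D fun n x => ?_, fun x hx => by simp [h2 0 x hx]⟩
  have e1 := hasDerivWithinAt_piece _ isClosed_Iic _ _ _ _ (h1 n) (h1 (n + 1))
    (fun x _ => (hasDerivAt_iterated g hg n x).hasDerivWithinAt) x
  have e3 := hasDerivWithinAt_piece _ isClosed_Ici _ _ _ _ (h3 n) (h3 (n + 1))
    (fun x _ => (hasDerivAt_iterated k hk n x).hasDerivWithinAt) x
  have e2 := hasDerivWithinAt_piece I isClosed_Icc _ _ _ _ (h2 n) (h2 (n + 1))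
    (fun x hx => by
      rw [iteratedDerivWithin_succ]
      exact (hf.differentiableOn_iteratedDerivWithin
        (mod_cast ENat.natCast_lt_top n) hud x hx).hasDerivWithinAt) x
  have e := (e1.union e2).union e3
  have hu : Iic (0 : ℝ) ∪ I ∪ Ici 1 = univ := by
    rw [hI, Iic_union_Icc_eq_Iic zero_le_one, Iic_union_Ici]
  rw [hu] at e
  exact hasDerivWithinAt_univ.1 e
end
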